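/- arXiv:2107.11772 — 4 statements merged into one kernel-verified Lean document; each statement's English description precedes it below -/
import Mathlib

section
/- Let K be a totally real number field of odd degree over ℚ and let O be an order in K (a subring of the ring of integers which is a finitely generated ℤ-module of rank [K : ℚ]). Then the Pythagoras number of O is at least 4; that is, there exists an element of O which is a sum of squares of elements of O but not a sum of three squares of elements of O. -/
open Polynomial in
/-- A nonzero polynomial of odd degree over a field has an irreducible factor of odd degree. -/
theorem exists_irreducible_dvd_of_odd_natDegree {F : Type*} [Field F] (h : F[X])
    (hodd : Odd h.natDegree) : ∃ p : F[X], Irreducible p ∧ p ∣ h ∧ Odd p.natDegree := by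
  induction h using WfDvdMonoid.induction_on_irreducible with
  | zero => simp at hodd
  | unit u hu => simp [natDegree_eq_zero_of_isUnit hu] at hodd
  | mul a i ha hi ih =>
    rw [natDegree_mul hi.ne_zero ha, Nat.odd_add] at hodd
    by_cases hio : Odd i.natDegree
    · exact ⟨i, hi, dvd_mul_right _ _, hio⟩
    · obtain ⟨p, hp, hpa, hpo⟩ := ih (by grind)
      exact ⟨p, hp, hpa.mul_left _, hpo⟩

open Polynomial in
/-- Values of an anisotropic diagonal form at polynomials have even degree. -/
theorem natDegree_diagonal_of_anisotropic {F ι : Type*} [Field F] [Fintype ι] (w : ι → F)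
    (hw : ∀ x : ι → F, ∑ i, w i * x i ^ 2 = 0 → x = 0) (g : ι → F[X]) (hg : g ≠ 0) :
    ∑ i, C (w i) * g i ^ 2 ≠ 0 ∧
      (∑ i, C (w i) * g i ^ 2).natDegree = 2 * Finset.univ.sup fun i ↦ (g i).natDegree := by
  set m := Finset.univ.sup fun i ↦ (g i).natDegree with hm
  have hle (i : ι) : (g i).natDegree ≤ m :=
    Finset.le_sup (f := fun i ↦ (g i).natDegree) (Finset.mem_univ i)
  have hcoeff : (∑ i, C (w i) * g i ^ 2).coeff (2 * m) = ∑ i, w i * (g i).coeff m ^ 2 := by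
    simp only [finsetSum_coeff, coeff_C_mul]
    exact Finset.sum_congr rfl fun i _ ↦ by rw [coeff_pow_of_natDegree_le (hle i)]
  have hne : (∑ i, C (w i) * g i ^ 2).coeff (2 * m) ≠ 0 := by
    rw [hcoeff]
    intro h0
    have hz := hw _ h0
    obtain ⟨j, hj⟩ := Function.ne_iff.mp hg
    obtain ⟨k, -, hk⟩ := Finset.exists_mem_eq_sup Finset.univ ⟨j, Finset.mem_univ j⟩
      fun i ↦ (g i).natDegree
    have hgk : g k = 0 := by
      rw [← leadingCoeff_eq_zero, leadingCoeff, ← hk]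
      exact congrFun hz k
    have hm0 : m = 0 := by rw [hm, hk, hgk, natDegree_zero]
    apply hj
    have hj0 := hle j
    rw [hm0, Nat.le_zero] at hj0
    have hc := congrFun hz j
    rw [hm0] at hc
    rw [eq_C_of_natDegree_eq_zero hj0, hc]
    simp
  refine ⟨fun h0 ↦ hne (by rw [h0, coeff_zero]), le_antisymm ?_ (le_natDegree_of_ne_zero hne)⟩
  refine natDegree_sum_le_of_forall_le _ _ fun i _ ↦ ?_
  exact (natDegree_C_mul_le _ _).trans (natDegree_pow_le_of_le 2 (hle i))

open Polynomial in
/-- Springer's theorem for diagonal forms, in terms of polynomials: an anisotropic form stays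
anisotropic modulo an irreducible polynomial of odd degree. -/
theorem dvd_of_dvd_diagonal_of_odd_natDegree {F ι : Type*} [Field F] [Fintype ι] (w : ι → F)
    (hw : ∀ x : ι → F, ∑ i, w i * x i ^ 2 = 0 → x = 0) (f : F[X]) (hf : Irreducible f)
    (hodd : Odd f.natDegree) (v : ι → F[X]) (hv : f ∣ ∑ i, C (w i) * v i ^ 2) (i : ι) :
    f ∣ v i := by
  induction hd : f.natDegree using Nat.strong_induction_on generalizing f v i with
  | _ d ih =>
  by_contra hi
  obtain ⟨_⟩ : Nonempty (NormalizedGCDMonoid F[X]) := inferInstance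
  have hr : f ∣ ∑ j, C (w j) * (v j % f) ^ 2 := by
    rw [← dvd_sub_right hv, ← Finset.sum_sub_distrib]
    refine Finset.dvd_sum fun j _ ↦ ?_
    rw [← mul_sub, sq_sub_sq]
    have hmod : f ∣ v j - v j % f :=
      ⟨v j / f, sub_eq_iff_eq_add.mpr (EuclideanDomain.div_add_mod _ _).symm⟩
    exact (hmod.mul_left _).mul_left _
  obtain ⟨g, hg, hg1⟩ := Finset.extract_gcd (fun j ↦ v j % f) (s := Finset.univ)
    ⟨i, Finset.mem_univ i⟩
  set c := Finset.univ.gcd fun j ↦ v j % f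
  have hri : v i % f ≠ 0 := fun h ↦ hi (EuclideanDomain.mod_eq_zero.mp h)
  have hc0 : c ≠ 0 := fun h ↦ hri (by rw [hg i (Finset.mem_univ i), h, zero_mul])
  have hgi : g i ≠ 0 := fun h ↦ hri (by rw [hg i (Finset.mem_univ i), h, mul_zero])
  have hlt (j : ι) : (v j % f).natDegree < f.natDegree := natDegree_mod_lt _ hodd.pos.ne'
  have hfc : ¬ f ∣ c := fun h ↦
    (natDegree_le_of_dvd (h.trans (Finset.gcd_dvd (Finset.mem_univ i))) hri).not_gt (hlt i)
  have hglt (j : ι) : (g j).natDegree < f.natDegree := by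
    by_cases h0 : g j = 0
    · simpa [h0] using hodd.pos
    · have := hlt j
      rw [hg j (Finset.mem_univ j), natDegree_mul hc0 h0] at this
      omega
  have hfg : f ∣ ∑ j, C (w j) * g j ^ 2 := by
    have heq : ∑ j, C (w j) * (v j % f) ^ 2 = c ^ 2 * ∑ j, C (w j) * g j ^ 2 := by
      rw [Finset.mul_sum]
      exact Finset.sum_congr rfl fun j hj ↦ by rw [hg j hj]; ring
    rw [heq] at hr
    exact (hf.prime.dvd_or_dvd hr).resolve_left fun h ↦ hfc (hf.prime.dvd_of_dvd_pow h)
  obtain ⟨hne, hdeg⟩ := natDegree_diagonal_of_anisotropic w hw g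
    fun h ↦ hgi (congrFun h i)
  have hsup : (Finset.univ.sup fun j ↦ (g j).natDegree) < f.natDegree :=
    (Finset.sup_lt_iff hodd.pos).mpr fun j _ ↦ hglt j
  obtain ⟨h, hh⟩ := hfg
  have hh0 : h ≠ 0 := by rintro rfl; exact hne (by rw [hh, mul_zero])
  rw [hh, natDegree_mul hf.ne_zero hh0] at hdeg
  obtain ⟨p, hp, hph, hpo⟩ := exists_irreducible_dvd_of_odd_natDegree h (by grind)
  have hple := natDegree_le_of_dvd hph hh0
  have hall (j : ι) : p ∣ g j :=
    ih p.natDegree (by omega) p hp hpo g (hh ▸ hph.mul_left f) j rfl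
  exact hp.not_isUnit (isUnit_of_dvd_one (hg1 ▸ Finset.dvd_gcd fun j _ ↦ hall j))

open Polynomial in
/-- Springer's theorem for diagonal forms: an anisotropic form stays anisotropic in a separable
extension of odd degree. -/
theorem diagonal_anisotropic_of_odd_finrank {F L ι : Type*} [Field F] [Field L] [Algebra F L]
    [FiniteDimensional F L] [Algebra.IsSeparable F L] [Fintype ι]
    (hodd : Odd (Module.finrank F L)) (w : ι → F)
    (hw : ∀ x : ι → F, ∑ i, w i * x i ^ 2 = 0 → x = 0) (x : ι → L)
    (hx : ∑ i, algebraMap F L (w i) * x i ^ 2 = 0) : x = 0 := by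
  let B := Field.powerBasisOfFiniteOfSeparable F L
  choose g hg using fun i ↦ B.exists_eq_aeval' (x i)
  have hint : IsIntegral F B.gen := Algebra.IsIntegral.isIntegral _
  funext i
  rw [hg i]
  refine (minpoly.dvd_iff (A := F)).mp ?_
  refine dvd_of_dvd_diagonal_of_odd_natDegree w hw _ (minpoly.irreducible hint) ?_ g ?_ i
  · rwa [B.natDegree_minpoly, ← B.finrank]
  · rw [minpoly.dvd_iff]
    simpa [← hg] using hx

/-- Four integers with `a ^ 2 + b ^ 2 + c ^ 2 = 7 * d ^ 2` are all even. -/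
theorem even_of_sq_add_sq_add_sq_eq_seven_mul_sq {a b c d : ℤ}
    (h : a ^ 2 + b ^ 2 + c ^ 2 = 7 * d ^ 2) : 2 ∣ a ∧ 2 ∣ b ∧ 2 ∣ c ∧ 2 ∣ d := by
  have key : ∀ a b c d : ZMod 8, a ^ 2 + b ^ 2 + c ^ 2 = 7 * d ^ 2 →
      4 * a = 0 ∧ 4 * b = 0 ∧ 4 * c = 0 ∧ 4 * d = 0 := by decide +kernel
  have aux (n : ℤ) (hn : 4 * (n : ZMod 8) = 0) : 2 ∣ n := by
    have : ((4 * n : ℤ) : ZMod 8) = 0 := by push_cast; exact hn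
    rw [ZMod.intCast_zmod_eq_zero_iff_dvd] at this
    push_cast at this
    omega
  obtain ⟨ha, hb, hc, hd⟩ := key a b c d (by exact_mod_cast congrArg (Int.cast : ℤ → ZMod 8) h)
  exact ⟨aux a ha, aux b hb, aux c hc, aux d hd⟩

/-- The only integer solution of `a ^ 2 + b ^ 2 + c ^ 2 = 7 * d ^ 2` has `d = 0`. -/
theorem eq_zero_of_sq_add_sq_add_sq_eq_seven_mul_sq {a b c d : ℤ}
    (h : a ^ 2 + b ^ 2 + c ^ 2 = 7 * d ^ 2) : d = 0 := by
  induction hn : d.natAbs using Nat.strong_induction_on generalizing a b c d with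
  | _ n ih =>
  obtain ⟨⟨a', rfl⟩, ⟨b', rfl⟩, ⟨c', rfl⟩, ⟨d', rfl⟩⟩ :=
    even_of_sq_add_sq_add_sq_eq_seven_mul_sq h
  by_contra hd
  have := ih d'.natAbs (by omega) (a := a') (b := b') (c := c') (by linarith) rfl
  omega

/-- The form `x ^ 2 + y ^ 2 + z ^ 2 - 7 * t ^ 2` is anisotropic over `ℚ`. -/
theorem anisotropic_one_one_one_neg_seven (x : Fin 4 → ℚ)
    (hx : ∑ i, (![1, 1, 1, -7] : Fin 4 → ℚ) i * x i ^ 2 = 0) : x = 0 := by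
  simp only [Fin.sum_univ_four, Matrix.cons_val] at hx
  obtain ⟨⟨b, hb⟩, hbx⟩ := IsLocalization.exist_integer_multiples_of_finset
    (nonZeroDivisors ℤ) (Finset.univ.image x)
  have hb0 : (b : ℚ) ≠ 0 := by exact_mod_cast nonZeroDivisors.ne_zero hb
  choose y hy using fun i ↦ hbx (x i) (Finset.mem_image_of_mem x (Finset.mem_univ i))
  have hy' (i : Fin 4) : (y i : ℚ) = b * x i := by simpa using hy i
  have hint : y 0 ^ 2 + y 1 ^ 2 + y 2 ^ 2 = 7 * y 3 ^ 2 := by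
    have : ((y 0 ^ 2 + y 1 ^ 2 + y 2 ^ 2 : ℤ) : ℚ) = (7 * y 3 ^ 2 : ℤ) := by
      push_cast
      simp only [hy']
      linear_combination (b : ℚ) ^ 2 * hx
    exact_mod_cast this
  have hx3 : x 3 = 0 := by
    have := hy' 3
    rw [eq_zero_of_sq_add_sq_add_sq_eq_seven_mul_sq hint] at this
    simpa [hb0] using this.symm
  rw [hx3] at hx
  have h0 : x 0 ^ 2 = 0 := by linarith [sq_nonneg (x 0), sq_nonneg (x 1), sq_nonneg (x 2)]
  have h1 : x 1 ^ 2 = 0 := by linarith [sq_nonneg (x 0), sq_nonneg (x 1), sq_nonneg (x 2)]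
  have h2 : x 2 ^ 2 = 0 := by linarith [sq_nonneg (x 0), sq_nonneg (x 1), sq_nonneg (x 2)]
  funext i
  fin_cases i
  · exact pow_eq_zero_iff two_ne_zero |>.mp h0
  · exact pow_eq_zero_iff two_ne_zero |>.mp h1
  · exact pow_eq_zero_iff two_ne_zero |>.mp h2
  · exact hx3

/-- Let `K` be a totally real number field of odd degree over `ℚ` and let
`O` be an order in `K`, i.e. a subring of the ring of integers (all its elements are
integral over `ℤ`) which is a finitely generated `ℤ`-module of rank `[K : ℚ]`.
Then the Pythagoras number of `O` is at least `4`: there is an element of `O` which is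
a sum of squares in `O` but not a sum of three squares in `O`. -/
theorem pythagoras_number_of_order_in_totally_real_odd_degree_field_ge_four
    (K : Type*) [Field K] [NumberField K]
    (htotallyreal : ∀ σ : K →+* ℂ, ∀ x : K, (σ x).im = 0)
    (hodd : Odd (Module.finrank ℚ K))
    (O : Subring K)
    (hintegral : ∀ x ∈ O, IsIntegral ℤ x)
    (hfg : Module.Finite ℤ O)
    (hrank : Module.finrank ℤ O = Module.finrank ℚ K) :
    ∃ a : O, IsSumSq a ∧ ¬ ∃ x : Fin 3 → O, a = ∑ i, x i ^ 2 := by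
  refine ⟨7, ?_, ?_⟩
  · have h : (7 : O) = 1 * 1 + (1 * 1 + (1 * 1 + (2 * 2 + 0))) := by norm_num
    rw [h]
    exact .sq_add _ (.sq_add _ (.sq_add _ (.sq_add _ .zero)))
  · rintro ⟨x, hx⟩
    have hK : (7 : K) = (x 0 : K) ^ 2 + (x 1 : K) ^ 2 + (x 2 : K) ^ 2 := by
      have h := congrArg O.subtype hx
      rwa [Fin.sum_univ_three, map_ofNat, map_add, map_add, map_pow, map_pow, map_pow] at h
    have hzero := diagonal_anisotropic_of_odd_finrank hodd _ anisotropic_one_one_one_neg_seven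
      (![x 0, x 1, x 2, 1] : Fin 4 → K) (by
        simp [Fin.sum_univ_four]
        linear_combination -hK)
    simpa using congrFun hzero 3
end

section
/- Let L be a finite field extension of ℚ₂ of odd degree, and let 𝔒 be its ring of integers; assume 2 is a prime element of 𝔒. Then for any units u, v ∈ 𝔒, the element u² + v² is not a square in 𝔒. -/
/- Setting: `L` is a finite field extension of `ℚ₂` of odd degree, `𝔒` is its ring of
integers (the integral closure of `ℤ₂` in `L`), and `2` is a prime element of `𝔒`
(equivalently, `L/ℚ₂` is unramified). -/
/-- In a domain in which `2` is prime, a sum of two squares of units is never a square: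
a square root `w` of `u ^ 2 + v ^ 2` is congruent to `u + v` modulo `2`, whence `2 ∣ u * v`. -/
theorem not_isSquare_sq_add_sq_of_prime_two {R : Type*} [CommRing R] [IsDomain R]
    (h2 : Prime (2 : R)) (u v : Rˣ) : ¬ IsSquare ((u : R) ^ 2 + (v : R) ^ 2) := by
  rintro ⟨w, hw⟩
  have hdvd : (2 : R) ∣ (w - u - v) ^ 2 :=
    ⟨w ^ 2 + u * v - w * u - w * v, by linear_combination hw⟩
  obtain ⟨t, ht⟩ := h2.dvd_of_dvd_pow hdvd
  obtain rfl : w = u + v + 2 * t := by linear_combination ht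
  have huv : (u * v : R) = 2 * (-(t * (u + v) + t ^ 2)) :=
    mul_left_cancel₀ h2.ne_zero (by linear_combination -hw)
  exact h2.not_isUnit (isUnit_of_dvd_unit ⟨_, huv⟩ (u * v).isUnit)

/-- Let `L` be a finite extension of `ℚ₂` of odd degree with ring of
integers `𝔒 = integralClosure ℤ₂ L`, and assume `2` is a prime element of `𝔒`. Then
for any units `u, v ∈ 𝔒`, the element `u² + v²` is not a square in `𝔒`. -/
theorem sum_of_two_unit_squares_not_square_in_odd_unramified_dyadic
    (L : Type*) [Field L] [Algebra ℚ_[2] L] [FiniteDimensional ℚ_[2] L]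
    [Algebra ℤ_[2] L] [IsScalarTower ℤ_[2] ℚ_[2] L]
    (hodd : Odd (Module.finrank ℚ_[2] L))
    (h2 : Prime (2 : integralClosure ℤ_[2] L))
    (u v : (integralClosure ℤ_[2] L)ˣ) :
    ¬ IsSquare ((u : integralClosure ℤ_[2] L) ^ 2 + (v : integralClosure ℤ_[2] L) ^ 2) := by
  exact not_isSquare_sq_add_sq_of_prime_two h2 u v
end

section
/- Let L be a finite field extension of ℚ₂ of odd degree, and let 𝔒 be its ring of integers; assume 2 is a prime element of 𝔒. Then there do not exist a unit u ∈ 𝔒 and elements y, z ∈ 𝔒 such that u² + y² + z² ≡ 0 (mod 4). -/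
/-- In a finite commutative domain with `2 ^ n` elements, `n` odd, the polynomial `X ^ 2 + X + 1`
has no root. -/
theorem sq_add_self_add_one_ne_zero_of_natCard_eq_two_pow {k : Type*} [CommRing k] [IsDomain k]
    {n : ℕ} (hn : Odd n) (hk : Nat.card k = 2 ^ n) (htwo : (2 : k) = 0) (t : k) :
    t ^ 2 + t + 1 ≠ 0 := by
  intro ht
  have : Finite k := Nat.finite_of_card_ne_zero (by rw [hk]; positivity)
  let _ : Field k := (Finite.isField_of_domain k).toField
  have ht3 : t ^ 3 = 1 := by linear_combination (t - 1) * ht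
  have ht1 : t ≠ 1 := by
    rintro rfl
    exact one_ne_zero (α := k) (by linear_combination ht - htwo)
  have ht0 : t ≠ 0 := by
    rintro rfl
    simp at ht3
  have hord : orderOf (Units.mk0 t ht0) = 3 := by
    have : Fact (Nat.Prime 3) := ⟨Nat.prime_three⟩
    refine orderOf_eq_prime (Units.ext (by simpa using ht3)) fun h => ht1 ?_
    simpa using congrArg Units.val h
  have hdvd := orderOf_dvd_natCard (Units.mk0 t ht0)
  rw [hord, Nat.card_units, hk] at hdvd
  obtain ⟨m, rfl⟩ := hn
  have hmod : 2 ^ (2 * m + 1) % 3 = 2 := by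
    rw [pow_succ, pow_mul, Nat.mul_mod, Nat.pow_mod]
    norm_num
  have hpos : 0 < 2 ^ (2 * m + 1) := by positivity
  generalize 2 ^ (2 * m + 1) = q at hmod hdvd hpos
  omega

/-- If `2` is prime and the sum of a unit square and two squares is divisible by `4`, then
`X ^ 2 + X + 1` has a root modulo `2`. -/
theorem exists_two_dvd_sq_add_self_add_one {R : Type*} [CommRing R] [IsDomain R]
    (h2 : Prime (2 : R)) (u : Rˣ) (y z : R) (h : (4 : R) ∣ (u : R) ^ 2 + y ^ 2 + z ^ 2) :
    ∃ t : R, (2 : R) ∣ t ^ 2 + t + 1 := by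
  obtain ⟨c, hc⟩ := h
  have hsum : (2 : R) ∣ (u : R) + y + z := h2.dvd_of_dvd_pow (n := 2)
    ⟨2 * c + u * y + u * z + y * z, by linear_combination hc⟩
  obtain ⟨w, hw⟩ := hsum
  have hz : z = 2 * w - u - y := by linear_combination hw
  subst hz
  have hquad : (u : R) ^ 2 + u * y + y ^ 2 = 2 * (c - w ^ 2 + w * (u + y)) :=
    mul_left_cancel₀ h2.ne_zero (by linear_combination hc)
  have hinv : (u : R) * ((u⁻¹ : Rˣ) : R) = 1 := u.mul_inv
  refine ⟨y * ((u⁻¹ : Rˣ) : R), (c - w ^ 2 + w * (u + y)) * ((u⁻¹ : Rˣ) : R) ^ 2, ?_⟩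
  linear_combination ((u⁻¹ : Rˣ) : R) ^ 2 * hquad -
    (1 + (u : R) * ((u⁻¹ : Rˣ) : R) + y * ((u⁻¹ : Rˣ) : R)) * hinv

/-- A finite free algebra `S` over a local ring `R` with residue field `k` satisfies
`#(S / 𝔪 S) = (#k) ^ rank S`. -/
theorem natCard_quotient_map_maximalIdeal (R S : Type*) [CommRing R] [IsLocalRing R] [CommRing S]
    [Algebra R S] [Module.Finite R S] [Module.Free R S] :
    Nat.card (S ⧸ Ideal.map (algebraMap R S) (IsLocalRing.maximalIdeal R)) =
      Nat.card (R ⧸ IsLocalRing.maximalIdeal R) ^ Module.finrank R S := by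
  let _ : Field (R ⧸ IsLocalRing.maximalIdeal R) := Ideal.Quotient.field _
  have : Module.Finite (R ⧸ IsLocalRing.maximalIdeal R)
      (S ⧸ Ideal.map (algebraMap R S) (IsLocalRing.maximalIdeal R)) :=
    Module.Finite.of_restrictScalars_finite R _ _
  rw [Module.natCard_eq_pow_finrank (K := R ⧸ IsLocalRing.maximalIdeal R),
    IsLocalRing.finrank_quotient_map]

/-- The quotient of the ring of integers of a finite extension `L` of `ℚ_[p]` by `p` has
`p ^ [L : ℚ_[p]]` elements. -/
theorem natCard_integralClosure_padicInt_quotient_span (p : ℕ) [Fact p.Prime]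
    (L : Type*) [Field L] [Algebra ℚ_[p] L] [FiniteDimensional ℚ_[p] L]
    [Algebra ℤ_[p] L] [IsScalarTower ℤ_[p] ℚ_[p] L] :
    Nat.card (integralClosure ℤ_[p] L ⧸ Ideal.span {(p : integralClosure ℤ_[p] L)}) =
      p ^ Module.finrank ℚ_[p] L := by
  have : Module.IsTorsionFree ℤ_[p] L := .trans_faithfulSMul ℤ_[p] ℚ_[p] L
  have : Module.Finite ℤ_[p] (integralClosure ℤ_[p] L) :=
    IsIntegralClosure.finite ℤ_[p] ℚ_[p] L _
  have : Module.Free ℤ_[p] (integralClosure ℤ_[p] L) :=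
    IsIntegralClosure.module_free ℤ_[p] ℚ_[p] L _
  have hmap : Ideal.map (algebraMap ℤ_[p] (integralClosure ℤ_[p] L))
      (IsLocalRing.maximalIdeal ℤ_[p]) = Ideal.span {(p : integralClosure ℤ_[p] L)} := by
    rw [PadicInt.maximalIdeal_eq_span_p, Ideal.map_span, Set.image_singleton, map_natCast]
  have hres : Nat.card (ℤ_[p] ⧸ IsLocalRing.maximalIdeal ℤ_[p]) = p :=
    (Nat.card_congr PadicInt.residueField.toEquiv).trans (Nat.card_zmod p)
  rw [← hmap, natCard_quotient_map_maximalIdeal, hres,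
    IsIntegralClosure.rank ℤ_[p] ℚ_[p] L]

/- Setting: `L` is a finite field extension of `ℚ₂` of odd degree, `𝔒` is its ring of
integers (the integral closure of `ℤ₂` in `L`), and `2` is a prime element of `𝔒`
(equivalently, `L/ℚ₂` is unramified). -/
/-- Let `L` be a finite extension of `ℚ₂` of odd degree with ring of
integers `𝔒 = integralClosure ℤ₂ L`, and assume `2` is a prime element of `𝔒`. Then
there are no unit `u ∈ 𝔒` and elements `y, z ∈ 𝔒` with `u² + y² + z² ≡ 0 (mod 4)`. -/
theorem no_unit_square_plus_two_squares_divisible_by_four_in_odd_unramified_dyadic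
    (L : Type*) [Field L] [Algebra ℚ_[2] L] [FiniteDimensional ℚ_[2] L]
    [Algebra ℤ_[2] L] [IsScalarTower ℤ_[2] ℚ_[2] L]
    (hodd : Odd (Module.finrank ℚ_[2] L))
    (h2 : Prime (2 : integralClosure ℤ_[2] L)) :
    ¬ ∃ (u : (integralClosure ℤ_[2] L)ˣ) (y z : integralClosure ℤ_[2] L),
        (4 : integralClosure ℤ_[2] L) ∣ ((u : integralClosure ℤ_[2] L) ^ 2 + y ^ 2 + z ^ 2) := by
  rintro ⟨u, y, z, h⟩
  obtain ⟨t, ht⟩ := exists_two_dvd_sq_add_self_add_one h2 u y z h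
  have : (Ideal.span {(2 : integralClosure ℤ_[2] L)}).IsPrime :=
    (Ideal.span_singleton_prime h2.ne_zero).2 h2
  refine sq_add_self_add_one_ne_zero_of_natCard_eq_two_pow hodd
    (natCard_integralClosure_padicInt_quotient_span 2 L) ?_
    (Ideal.Quotient.mk (Ideal.span {(2 : integralClosure ℤ_[2] L)}) t) ?_
  · exact Ideal.Quotient.eq_zero_iff_mem.2 (Ideal.mem_span_singleton_self 2)
  · simpa using Ideal.Quotient.eq_zero_iff_mem.2 (Ideal.mem_span_singleton.2 ht)
end

section
/- Let θ = (1 + √17)/2 and let O = ℤ[θ] be the ring of integers of ℚ(√17). The element 7 + θ² is a sum of five squares of elements of O but is not a sum of four squares of elements of O; consequently the Pythagoras number of ℤ[(1+√17)/2] equals 5. -/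
noncomputable section

/-- `θ = (1 + √17)/2`, a generator of the ring of integers of `ℚ(√17)`. -/
def θ : ℝ := (1 + Real.sqrt 17) / 2

/-- `O = ℤ[θ] = ℤ[(1+√17)/2]`, the ring of integers of `ℚ(√17)`, realised inside `ℝ`. -/
def O17 : Subalgebra ℤ ℝ := Algebra.adjoin ℤ {θ}

/-- `θ` as an element of `O = ℤ[(1+√17)/2]`. -/
def θO : O17 := ⟨θ, Algebra.self_mem_adjoin_singleton ℤ θ⟩

/-- Binary integral form `a x² + 2 b x y + c y²` is a sum of five squares of integral linear forms. -/
def IsGramFive (a b c : ℤ) : Prop :=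
  ∃ u v : Fin 5 → ℤ, u ⬝ᵥ u = a ∧ u ⬝ᵥ v = b ∧ v ⬝ᵥ v = c

theorem IsGramFive.swap {a b c : ℤ} (h : IsGramFive a b c) : IsGramFive c b a := by
  obtain ⟨u, v, hu, huv, hv⟩ := h
  exact ⟨v, u, hv, by rw [dotProduct_comm, huv], hu⟩

theorem IsGramFive.shear {a b c : ℤ} (k : ℤ)
    (h : IsGramFive a (b + k * a) (c + 2 * k * b + k ^ 2 * a)) : IsGramFive a b c := by
  obtain ⟨u, v, hu, huv, hv⟩ := h
  refine ⟨u, v - k • u, hu, ?_, ?_⟩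
  · simp only [dotProduct_sub, dotProduct_smul, smul_eq_mul, hu, huv]
    ring
  · have huv' : v ⬝ᵥ u = b + k * a := by rw [dotProduct_comm, huv]
    simp only [dotProduct_sub, dotProduct_smul, sub_dotProduct, smul_dotProduct, smul_eq_mul, hu,
      huv, huv', hv]
    ring

theorem exists_two_mul_add_mul_mem_Ico (b : ℤ) {a : ℤ} (ha : 0 < a) :
    ∃ k : ℤ, -a ≤ 2 * (b + k * a) ∧ 2 * (b + k * a) < a := by
  refine ⟨-((2 * b + a) / (2 * a)), ?_⟩
  have h1 := Int.emod_add_mul_ediv (2 * b + a) (2 * a)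
  have h2 := Int.emod_nonneg (2 * b + a) (b := 2 * a) (by omega)
  have h3 := Int.emod_lt_of_pos (2 * b + a) (b := 2 * a) (by omega)
  constructor <;> nlinarith

theorem exists_abs_two_mul_add_mul_le (b : ℤ) {a : ℤ} (ha : 0 < a) :
    ∃ k : ℤ, |2 * (b + k * a)| ≤ a := by
  obtain ⟨k, h1, h2⟩ := exists_two_mul_add_mul_mem_Ico b ha
  exact ⟨k, abs_le.2 ⟨h1, h2.le⟩⟩

/-- The ternary form with diagonal `a, b, c` and off-diagonal coefficients `r = (2,3)`,
`s = (1,3)`, `t = (1,2)` is a sum of three squares of integral linear forms. -/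
def IsGramThree (a b c r s t : ℤ) : Prop :=
  ∃ u v w : Fin 3 → ℤ, u ⬝ᵥ u = a ∧ v ⬝ᵥ v = b ∧ w ⬝ᵥ w = c ∧
    v ⬝ᵥ w = r ∧ u ⬝ᵥ w = s ∧ u ⬝ᵥ v = t

namespace IsGramThree

variable {a b c r s t : ℤ}

theorem swap_fst_snd (h : IsGramThree b a c s r t) : IsGramThree a b c r s t := by
  obtain ⟨u, v, w, hu, hv, hw, hr, hs, ht⟩ := h
  exact ⟨v, u, w, hv, hu, hw, hs, hr, by rw [dotProduct_comm, ht]⟩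

theorem swap_snd_thd (h : IsGramThree a c b r t s) : IsGramThree a b c r s t := by
  obtain ⟨u, v, w, hu, hv, hw, hr, hs, ht⟩ := h
  exact ⟨u, w, v, hu, hw, hv, by rw [dotProduct_comm, hr], ht, hs⟩

theorem shear_snd_thd (k : ℤ)
    (h : IsGramThree a b (c + 2 * k * r + k ^ 2 * b) (r + k * b) (s + k * t) t) :
    IsGramThree a b c r s t := by
  obtain ⟨u, v, w, hu, hv, hw, hr, hs, ht⟩ := h
  have hr' : w ⬝ᵥ v = r + k * b := by rw [dotProduct_comm, hr]
  refine ⟨u, v, w - k • v, hu, hv, ?_, ?_, ?_, ht⟩ <;>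
  · simp only [dotProduct_sub, dotProduct_smul, sub_dotProduct, smul_dotProduct, smul_eq_mul,
      hv, hw, hr, hr', hs, ht]
    ring

theorem shear_fst_thd (k : ℤ)
    (h : IsGramThree a b (c + 2 * k * s + k ^ 2 * a) (r + k * t) (s + k * a) t) :
    IsGramThree a b c r s t :=
  swap_fst_snd (shear_snd_thd k (swap_fst_snd h))

theorem shear_fst_snd (k : ℤ)
    (h : IsGramThree a (b + 2 * k * t + k ^ 2 * a) c (r + k * s) s (t + k * a)) :
    IsGramThree a b c r s t :=
  swap_snd_thd (shear_fst_thd k (swap_snd_thd h))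

end IsGramThree

theorem isGramThree_of_det_eq_one (a m : ℕ) : ∀ b c r s t : ℤ, 0 < a → 0 < m → a * b - t ^ 2 = m →
    a * b * c + 2 * r * s * t - a * r ^ 2 - b * s ^ 2 - c * t ^ 2 = 1 →
    IsGramThree a b c r s t := by
  induction a using Nat.strong_induction_on generalizing m with | _ a iha =>
  induction m using Nat.strong_induction_on with | _ m ihm =>
  intro b c r s t ha hm hmdef hdet
  have ha' : (0 : ℤ) < a := by exact_mod_cast ha
  have hm' : (0 : ℤ) < m := by exact_mod_cast hm
  obtain ⟨k, hk⟩ := exists_abs_two_mul_add_mul_le (a * r - s * t) hm'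
  apply IsGramThree.shear_snd_thd k
  have hdet' : a * b * (c + 2 * k * r + k ^ 2 * b) + 2 * (r + k * b) * (s + k * t) * t
      - a * (r + k * b) ^ 2 - b * (s + k * t) ^ 2 - (c + 2 * k * r + k ^ 2 * b) * t ^ 2 = 1 := by
    linear_combination hdet
  have hk' : |2 * (a * (r + k * b) - (s + k * t) * t)| ≤ (m : ℤ) := by
    convert hk using 3
    rw [← hmdef]; ring
  generalize c + 2 * k * r + k ^ 2 * b = c at *
  generalize r + k * b = r at *
  generalize s + k * t = s at *
  clear hk hdet
  have hg : m * (a * c - s ^ 2) = a + (a * r - s * t) ^ 2 := by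
    rw [← hmdef]; linear_combination a * hdet'
  have hn : 0 < a * c - s ^ 2 := by
    by_contra! h
    nlinarith [sq_nonneg (a * r - s * t)]
  have hsq : 4 * (a * r - s * t) ^ 2 ≤ (m : ℤ) ^ 2 := by
    have := sq_le_sq.2 (hk'.trans (le_abs_self _))
    linarith
  by_cases hlt : a * c - s ^ 2 < m
  · obtain ⟨m', hm''⟩ := Int.eq_ofNat_of_zero_le hn.le
    apply IsGramThree.swap_snd_thd
    exact ihm m' (by omega) c b r t s ha (by omega) hm'' (by linear_combination hdet')
  · have h3 : 3 * (m : ℤ) ^ 2 ≤ 4 * a := by nlinarith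
    obtain ⟨l, hl⟩ := exists_abs_two_mul_add_mul_le t ha'
    apply IsGramThree.shear_fst_snd l
    have hmdef' : a * (b + 2 * l * t + l ^ 2 * a) - (t + l * a) ^ 2 = m := by
      linear_combination hmdef
    have hdet : a * (b + 2 * l * t + l ^ 2 * a) * c + 2 * (r + l * s) * s * (t + l * a)
      - a * (r + l * s) ^ 2 - (b + 2 * l * t + l ^ 2 * a) * s ^ 2 - c * (t + l * a) ^ 2 = 1 := by
      linear_combination hdet'
    have hk : |2 * (a * (r + l * s) - s * (t + l * a))| ≤ (m : ℤ) := by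
      convert hk' using 3
      ring
    generalize b + 2 * l * t + l ^ 2 * a = b at *
    generalize r + l * s = r at *
    generalize t + l * a = t at *
    have ht : 4 * t ^ 2 ≤ (a : ℤ) ^ 2 := by
      have := sq_le_sq.2 (hl.trans (le_abs_self _))
      linarith
    have hb : 0 < b := by
      by_contra! h
      nlinarith [sq_nonneg t]
    rcases Nat.lt_or_ge 1 a with h1 | h1
    · have h1' : (2 : ℤ) ≤ a := by exact_mod_cast h1
      have hba : b < a := by
        by_contra! h
        have : (a : ℤ) * a ≤ a * b := by gcongr
        nlinarith
      obtain ⟨b', rfl⟩ := Int.eq_ofNat_of_zero_le hb.le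
      apply IsGramThree.swap_fst_snd
      exact iha b' (by omega) m a c s r t (by omega) hm (by linear_combination hmdef')
        (by linear_combination hdet)
    · obtain rfl : a = 1 := by omega
      obtain rfl : m = 1 := by
        rw [Nat.cast_one] at h3
        have : (m : ℤ) < 2 := by nlinarith only [h3]
        omega
      simp only [Nat.cast_one, one_mul] at *
      obtain rfl : t = 0 := by rw [abs_le] at hl; omega
      obtain rfl : r = 0 := by rw [abs_le] at hk; omega
      obtain rfl : b = 1 := by linarith
      apply IsGramThree.shear_fst_thd (-s)
      refine ⟨Pi.single 0 1, Pi.single 1 1, Pi.single 2 1, ?_⟩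
      simp
      linarith

theorem exists_three_squares_of_dvd {n d k t : ℤ} (hd : 0 < d) (hk : 0 < k) (h : d * n - k = 1)
    (hdvd : k ∣ t ^ 2 + d) : ∃ x y z : ℤ, n = x ^ 2 + y ^ 2 + z ^ 2 := by
  obtain ⟨a, ha⟩ := hdvd
  have ha0 : 0 < a := by
    by_contra! h
    nlinarith [sq_nonneg t]
  obtain ⟨a, rfl⟩ := Int.eq_ofNat_of_zero_le ha0.le
  obtain ⟨d, rfl⟩ := Int.eq_ofNat_of_zero_le hd.le
  obtain ⟨u, v, w, -, -, hw, -⟩ := isGramThree_of_det_eq_one a d k n 0 1 t (by omega) (by omega)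
    (by linarith) (by linear_combination (-n) * ha + h)
  refine ⟨w 0, w 1, w 2, ?_⟩
  rw [← hw, dotProduct, Fin.sum_univ_three]
  ring

theorem exists_dvd_sq_add_of_jacobiSym {p d : ℕ} (hp : p.Prime) (h : jacobiSym (-d) p = 1) :
    ∃ t : ℤ, (p : ℤ) ∣ t ^ 2 + d := by
  have : Fact p.Prime := ⟨hp⟩
  obtain ⟨t, ht⟩ := ZMod.isSquare_of_jacobiSym_eq_one h
  obtain ⟨t, rfl⟩ := ZMod.intCast_surjective t
  refine ⟨t, ?_⟩
  rw [← ZMod.intCast_zmod_eq_zero_iff_dvd]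
  push_cast at ht ⊢
  rw [sq, ← ht]
  ring

theorem exists_three_squares_of_mod_four_eq_two {n : ℕ} (hn : n % 4 = 2) :
    ∃ x y z : ℤ, (n : ℤ) = x ^ 2 + y ^ 2 + z ^ 2 := by
  have hcop : (n - 1).Coprime (4 * n) := by
    have h2 : (n - 1).Coprime n := by
      rw [Nat.coprime_self_sub_left (by omega)]
      exact Nat.coprime_one_left n
    have h4 : (n - 1).Coprime (2 ^ 2) :=
      Nat.Coprime.pow_right 2 (Nat.coprime_two_right.2 (Nat.odd_iff.2 (by omega)))
    exact h4.mul_right h2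
  obtain ⟨p, hpn, hp, hmod⟩ := Nat.forall_exists_prime_gt_and_modEq n (by omega) hcop
  obtain ⟨j, hj⟩ := (Nat.modEq_iff_dvd' (by omega)).1 hmod.symm
  have hpj : p + 1 = (4 * j + 1) * n := by
    have : p + 1 = 4 * n * j + n := by omega
    rw [this]; ring
  have hp4 : p % 4 = 1 := by
    have : p + 1 = 4 * (j * n) + n := by rw [hpj]; ring
    omega
  have hd : Odd (4 * j + 1) := Nat.odd_iff.2 (by omega)
  have hjac : jacobiSym (-(4 * j + 1 : ℕ)) p = 1 := by
    rw [jacobiSym.neg _ (Nat.odd_iff.2 (by omega)), ZMod.χ₄_nat_one_mod_four hp4, one_mul,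
      jacobiSym.quadratic_reciprocity_one_mod_four (by omega) (Nat.odd_iff.2 (by omega)),
      jacobiSym.mod_left' (a₂ := -1), jacobiSym.at_neg_one hd, ZMod.χ₄_nat_one_mod_four (by omega)]
    apply Int.ModEq.symm
    rw [Int.modEq_iff_dvd]
    exact ⟨n, by push_cast; linarith [congrArg (Nat.cast : ℕ → ℤ) hpj]⟩
  obtain ⟨t, ht⟩ := exists_dvd_sq_add_of_jacobiSym hp hjac
  refine exists_three_squares_of_dvd (d := (4 * j + 1 : ℕ)) (by positivity)
    (by exact_mod_cast hp.pos) ?_ ht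
  have : (p : ℤ) + 1 = ((4 * j + 1 : ℕ) : ℤ) * n := by exact_mod_cast hpj
  linarith

theorem exists_three_squares_of_mod_four_eq_one {n : ℕ} (hn : n % 4 = 1) :
    ∃ x y z : ℤ, (n : ℤ) = x ^ 2 + y ^ 2 + z ^ 2 := by
  obtain ⟨m, hm⟩ : ∃ m, 2 * m + 1 = 3 * n := ⟨(3 * n - 1) / 2, by omega⟩
  have hcop : m.Coprime (4 * n) := by
    have h2 : m.Coprime n := by
      rw [← Nat.isCoprime_iff_coprime]
      exact ⟨-2, 3, by linarith [congrArg (Nat.cast : ℕ → ℤ) hm]⟩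
    have h4 : m.Coprime (2 ^ 2) :=
      Nat.Coprime.pow_right 2 (Nat.coprime_two_right.2 (Nat.odd_iff.2 (by omega)))
    exact h4.mul_right h2
  obtain ⟨p, hpn, hp, hmod⟩ := Nat.forall_exists_prime_gt_and_modEq (m + 2) (by omega) hcop
  obtain ⟨j, hj⟩ := (Nat.modEq_iff_dvd' (by omega)).1 hmod.symm
  have hpj : 2 * p + 1 = (8 * j + 3) * n := by
    have : 2 * p + 1 = 8 * (n * j) + 3 * n := by
      rw [mul_assoc] at hj
      omega
    rw [this]; ring
  have hp2 : 2 * p + 1 = 8 * (j * n) + 3 * n := by rw [hpj]; ring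
  have hpodd : Odd p := Nat.odd_iff.2 (by omega)
  have hd : Odd (8 * j + 3) := Nat.odd_iff.2 (by omega)
  have hpd : jacobiSym p (8 * j + 3) = 1 := by
    have h1 : jacobiSym (2 * p) (8 * j + 3) = -1 := by
      rw [jacobiSym.mod_left' (a₂ := -1), jacobiSym.at_neg_one hd,
        ZMod.χ₄_nat_three_mod_four (by omega)]
      apply Int.ModEq.symm
      rw [Int.modEq_iff_dvd]
      exact ⟨n, by push_cast; linarith [congrArg (Nat.cast : ℕ → ℤ) hpj]⟩
    have h2 : jacobiSym 2 (8 * j + 3) = -1 := by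
      rw [jacobiSym.at_two hd, ZMod.χ₈_nat_eq_if_mod_eight]
      have h8 : (8 * j + 3) % 8 = 3 := by omega
      have h8' : (8 * j + 3) % 2 = 1 := by omega
      simp [h8, h8']
    rw [jacobiSym.mul_left, h2] at h1
    linarith
  have hjac : jacobiSym (-(8 * j + 3 : ℕ)) p = 1 := by
    rw [jacobiSym.neg _ hpodd]
    rcases (by omega : p % 4 = 1 ∨ p % 4 = 3) with h | h
    · rw [ZMod.χ₄_nat_one_mod_four h, jacobiSym.quadratic_reciprocity_one_mod_four' hd h, hpd,
        one_mul]
    · rw [ZMod.χ₄_nat_three_mod_four h,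
        jacobiSym.quadratic_reciprocity_three_mod_four (by omega) h, hpd]
      norm_num
  obtain ⟨t, ht⟩ := exists_dvd_sq_add_of_jacobiSym hp hjac
  obtain ⟨t, ht, ht2⟩ : ∃ t : ℤ, (p : ℤ) ∣ t ^ 2 + (8 * j + 3 : ℕ) ∧ t % 2 = 1 := by
    rcases Int.emod_two_eq_zero_or_one t with h | h
    · refine ⟨t + p, ?_, by have := Nat.odd_iff.1 hpodd; omega⟩
      rw [show (t + p) ^ 2 + ((8 * j + 3 : ℕ) : ℤ) = t ^ 2 + (8 * j + 3 : ℕ) + p * (2 * t + p) by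
        ring]
      exact dvd_add ht (dvd_mul_right _ _)
    · exact ⟨t, ht, h⟩
  have h2 : (2 : ℤ) ∣ t ^ 2 + (8 * j + 3 : ℕ) := by
    rw [← even_iff_two_dvd]
    exact (Int.odd_iff.2 ht2).pow.add_odd (by exact_mod_cast hd)
  have hcop2 : IsCoprime (2 : ℤ) p := by
    exact_mod_cast Nat.isCoprime_iff_coprime.2 (Nat.coprime_two_left.2 hpodd)
  refine exists_three_squares_of_dvd (d := (8 * j + 3 : ℕ)) (k := 2 * p) (by positivity)
    (by have := hp.pos; positivity) ?_ (hcop2.mul_dvd h2 ht)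
  have : 2 * (p : ℤ) + 1 = ((8 * j + 3 : ℕ) : ℤ) * n := by exact_mod_cast hpj
  linarith

theorem exists_three_squares {n : ℤ} (hn0 : 0 ≤ n) (hn : n % 4 = 1 ∨ n % 4 = 2) :
    ∃ x y z : ℤ, n = x ^ 2 + y ^ 2 + z ^ 2 := by
  obtain ⟨n, rfl⟩ := Int.eq_ofNat_of_zero_le hn0
  rcases hn with hn | hn
  · exact exists_three_squares_of_mod_four_eq_one (by omega)
  · exact exists_three_squares_of_mod_four_eq_two (by omega)

open scoped Quaternion in
theorem Quaternion.exists_of_coords (p q r s : ℤ) :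
    ∃ x : ℍ[ℤ], x.re = p ∧ x.imI = q ∧ x.imJ = r ∧ x.imK = s :=
  ⟨⟨p, q, r, s⟩, rfl, rfl, rfl, rfl⟩

open scoped Quaternion in
theorem Quaternion.exists_normSq_eq (n : ℕ) : ∃ x : ℍ[ℤ], normSq x = n := by
  obtain ⟨a, b, c, d, h⟩ := Nat.sum_four_squares n
  obtain ⟨x, ha, hb, hc, hd⟩ := exists_of_coords a b c d
  refine ⟨x, ?_⟩
  rw [normSq_def', ha, hb, hc, hd]
  exact_mod_cast h

open scoped Quaternion in
/-- A singular positive semidefinite Hermitian matrix over the Lipschitz quaternions has a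
factorization `v * vᴴ`. -/
theorem Quaternion.exists_mul_star_eq (a : ℕ) : ∀ (c : ℕ) (γ : ℍ[ℤ]), normSq γ = a * c →
    ∃ x y : ℍ[ℤ], normSq x = a ∧ normSq y = c ∧ x * star y = γ := by
  induction a using Nat.strong_induction_on with | _ a ih =>
  intro c γ h
  rcases Nat.eq_zero_or_pos a with rfl | ha
  · obtain ⟨y, hy⟩ := exists_normSq_eq c
    refine ⟨0, y, by simp, hy, ?_⟩
    rw [zero_mul, eq_comm, ← normSq_eq_zero, h]
    simp
  have ha' : (0 : ℤ) < a := by exact_mod_cast ha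
  obtain ⟨k₀, h₀⟩ := exists_two_mul_add_mul_mem_Ico γ.re ha'
  obtain ⟨k₁, h₁⟩ := exists_two_mul_add_mul_mem_Ico γ.imI ha'
  obtain ⟨k₂, h₂⟩ := exists_two_mul_add_mul_mem_Ico γ.imJ ha'
  obtain ⟨k₃, h₃⟩ := exists_two_mul_add_mul_mem_Ico γ.imK ha'
  obtain ⟨τ, hτ₀, hτ₁, hτ₂, hτ₃⟩ := exists_of_coords k₀ k₁ k₂ k₃
  suffices key : ∃ x y : ℍ[ℤ], normSq x = a ∧ x * star y = γ + (a : ℤ) • τ by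
    obtain ⟨x, y, hx, hxy⟩ := key
    have hxy' : x * star (y - star τ * x) = γ := by
      rw [star_sub, star_mul, star_star, mul_sub, hxy, ← mul_assoc, self_mul_star, hx,
        coe_mul_eq_smul, add_sub_cancel_right]
    refine ⟨x, y - star τ * x, hx, ?_, hxy'⟩
    have := congrArg normSq hxy'
    rw [map_mul, normSq_star, hx, h] at this
    exact mul_left_cancel₀ ha'.ne' this
  obtain ⟨γ', hγ'⟩ : ∃ γ', γ' = γ + (a : ℤ) • τ := ⟨_, rfl⟩
  rw [← hγ']
  have e₀ : γ'.re = γ.re + k₀ * a := by rw [hγ']; simp [hτ₀, mul_comm]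
  have e₁ : γ'.imI = γ.imI + k₁ * a := by rw [hγ']; simp [hτ₁, mul_comm]
  have e₂ : γ'.imJ = γ.imJ + k₂ * a := by rw [hγ']; simp [hτ₂, mul_comm]
  have e₃ : γ'.imK = γ.imK + k₃ * a := by rw [hγ']; simp [hτ₃, mul_comm]
  rw [← e₀] at h₀
  rw [← e₁] at h₁
  rw [← e₂] at h₂
  rw [← e₃] at h₃
  obtain ⟨c', hc'⟩ : ∃ c' : ℤ, normSq γ' = a * c' := by
    refine ⟨c + 2 * (γ.re * k₀ + γ.imI * k₁ + γ.imJ * k₂ + γ.imK * k₃)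
      + a * (k₀ ^ 2 + k₁ ^ 2 + k₂ ^ 2 + k₃ ^ 2), ?_⟩
    rw [normSq_def'] at h ⊢
    rw [e₀, e₁, e₂, e₃]
    linear_combination h
  have hN := hc'
  rw [normSq_def'] at hN
  have sq_le : ∀ z : ℤ, -a ≤ 2 * z ∧ 2 * z < a → 4 * z ^ 2 ≤ (a : ℤ) ^ 2 := by
    rintro z ⟨h1, h2⟩
    nlinarith
  have s₀ := sq_le _ h₀
  have s₁ := sq_le _ h₁
  have s₂ := sq_le _ h₂
  have s₃ := sq_le _ h₃
  have hc0 : 0 ≤ c' := by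
    have := normSq_nonneg (a := γ')
    rw [hc'] at this
    exact nonneg_of_mul_nonneg_right this ha'
  have hca : c' ≤ a := by
    by_contra! hlt
    nlinarith
  obtain ⟨c', rfl⟩ := Int.eq_ofNat_of_zero_le hc0
  rcases (Nat.cast_le.1 hca).lt_or_eq with hlt | rfl
  · obtain ⟨x, y, hx, hy, hxy⟩ := ih c' hlt a (star γ') (by rw [normSq_star, hc', mul_comm])
    refine ⟨y, x, hy, ?_⟩
    rw [← star_star γ', ← hxy, star_mul, star_star]
  · have eq_neg : ∀ z : ℤ, -c' ≤ 2 * z ∧ 2 * z < c' → (c' : ℤ) ^ 2 ≤ 4 * z ^ 2 → 2 * z = -c' := by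
      rintro z ⟨h1, h2⟩ h3
      nlinarith
    have t₀ := eq_neg _ h₀ (by linarith)
    have t₁ := eq_neg _ h₁ (by linarith)
    have t₂ := eq_neg _ h₂ (by linarith)
    have t₃ := eq_neg _ h₃ (by linarith)
    obtain ⟨m, rfl⟩ : ∃ m, c' = 2 * m := ⟨c' / 2, by omega⟩
    obtain ⟨ν, hν⟩ := exists_normSq_eq m
    obtain ⟨x, hx₀, hx₁, hx₂, hx₃⟩ := exists_of_coords (-1) (-1) 0 0
    obtain ⟨y, hy₀, hy₁, hy₂, hy₃⟩ := exists_of_coords 1 0 (-1) 0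
    refine ⟨x * ν, y * ν, ?_, ?_⟩
    · rw [map_mul, hν, normSq_def', hx₀, hx₁, hx₂, hx₃]
      push_cast
      ring
    · rw [star_mul, mul_assoc, ← mul_assoc ν, self_mul_star, hν, coe_mul_eq_smul, mul_smul_comm]
      push_cast at t₀ t₁ t₂ t₃
      ext <;> simp only [re_smul, imI_smul, imJ_smul, imK_smul, re_mul, imI_mul, imJ_mul, imK_mul,
        re_star, imI_star, imJ_star, imK_star, hx₀, hx₁, hx₂, hx₃, hy₀, hy₁, hy₂, hy₃,
        smul_eq_mul] <;> linarith

namespace IsGramFive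

variable {a b c : ℤ}

theorem double_left (h : IsGramFive a b c) : IsGramFive (4 * a) (2 * b) c := by
  obtain ⟨u, v, hu, huv, hv⟩ := h
  refine ⟨(2 : ℤ) • u, v, ?_, ?_, hv⟩
  · simp only [dotProduct_smul, smul_dotProduct, smul_eq_mul, hu]
    ring
  · simp only [smul_dotProduct, smul_eq_mul, huv]

theorem of_det_eq_sum_three_squares {p q r : ℤ} (s t : ℤ) (ha : s ^ 2 ≤ a) (hc : t ^ 2 ≤ c)
    (h : (a - s ^ 2) * (c - t ^ 2) - (b - s * t) ^ 2 = p ^ 2 + q ^ 2 + r ^ 2) :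
    IsGramFive a b c := by
  obtain ⟨a', ha'⟩ := Int.eq_ofNat_of_zero_le (sub_nonneg.2 ha)
  obtain ⟨c', hc'⟩ := Int.eq_ofNat_of_zero_le (sub_nonneg.2 hc)
  obtain ⟨γ, h₀, h₁, h₂, h₃⟩ := Quaternion.exists_of_coords (b - s * t) p q r
  rw [ha', hc'] at h
  obtain ⟨x, y, hx, hy, hxy⟩ := Quaternion.exists_mul_star_eq a' c' γ (by
    rw [Quaternion.normSq_def', h₀, h₁, h₂, h₃]
    linarith)
  have hre := congrArg (fun z => z.re) hxy
  simp only [Quaternion.re_mul, Quaternion.re_star, Quaternion.imI_star, Quaternion.imJ_star,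
    Quaternion.imK_star, h₀] at hre
  rw [Quaternion.normSq_def'] at hx hy
  refine ⟨![x.re, x.imI, x.imJ, x.imK, s], ![y.re, y.imI, y.imJ, y.imK, t], ?_, ?_, ?_⟩ <;>
  · simp [dotProduct, Fin.sum_univ_five]
    linarith

end IsGramFive

/-- **Mordell's theorem**: a positive semidefinite binary form `a x² + 2 b x y + c y²` over `ℤ` is a
sum of five squares of integral linear forms. -/
theorem isGramFive_of_det_eq (D : ℕ) : ∀ (a : ℕ) (b c : ℤ), 0 ≤ c → a * c - b ^ 2 = D →
    IsGramFive a b c := by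
  induction D using Nat.strong_induction_on with | _ D ihD =>
  intro a
  induction a using Nat.strong_induction_on with | _ a iha =>
  intro b c hc hdet
  rcases Nat.eq_zero_or_pos a with rfl | ha
  · have hb : b = 0 := by
      rw [← sq_eq_zero_iff]
      push_cast at hdet
      nlinarith [sq_nonneg b]
    exact IsGramFive.of_det_eq_sum_three_squares (p := 0) (q := 0) (r := 0) 0 0 (by simp)
      (by simpa using hc) (by simp [hb])
  have ha' : (0 : ℤ) < a := by exact_mod_cast ha
  obtain ⟨k, hk⟩ := exists_abs_two_mul_add_mul_le b ha'
  apply IsGramFive.shear k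
  have hdet' : a * (c + 2 * k * b + k ^ 2 * a) - (b + k * a) ^ 2 = D := by
    linear_combination hdet
  generalize c + 2 * k * b + k ^ 2 * a = c at *
  generalize b + k * a = b at *
  have hc : 0 ≤ c := by
    by_contra! h
    nlinarith [sq_nonneg b]
  rcases lt_or_ge c a with hca | hca
  · obtain ⟨c, rfl⟩ := Int.eq_ofNat_of_zero_le hc
    exact (iha c (by omega) b a ha'.le (by linear_combination hdet')).swap
  have hsq : 4 * b ^ 2 ≤ (a : ℤ) ^ 2 := by
    have := sq_le_sq.2 (hk.trans (le_abs_self _))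
    linarith
  have hac : (a : ℤ) * a ≤ a * c := by gcongr
  have hmod : ((a : ℤ) % 4 * (c % 4) - b % 4 * (b % 4)) % 4 = D % 4 := by
    rw [← hdet', sq]
    simp [Int.sub_emod, Int.mul_emod]
  rcases (by omega : (D : ℤ) % 4 = 0 ∨ ((D : ℤ) % 4 = 1 ∨ (D : ℤ) % 4 = 2) ∨ (D : ℤ) % 4 = 3)
    with hD | hD | hD
  · have hsuper : ∀ a' b' c' : ℤ, 0 ≤ a' → 0 ≤ c' → a' * c' - b' ^ 2 = D → a' % 4 = 0 →
        b' % 2 = 0 → IsGramFive a' b' c' := by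
      intro a' b' c' ha0 hc0 hdet4 ha4 hb2
      obtain ⟨b', rfl⟩ := Int.dvd_of_emod_eq_zero hb2
      obtain ⟨a', rfl⟩ := Int.dvd_of_emod_eq_zero ha4
      obtain ⟨a', rfl⟩ := Int.eq_ofNat_of_zero_le (by omega : 0 ≤ a')
      obtain ⟨D', rfl⟩ : ∃ D', D = 4 * D' := ⟨D / 4, by omega⟩
      refine (ihD D' ?_ a' b' c' hc0 ?_).double_left
      · have : (0 : ℤ) < (4 * D' : ℕ) := by nlinarith
        omega
      · push_cast at hdet4
        linarith
    have hcases : (a : ℤ) % 4 = 0 ∧ b % 2 = 0 ∨ c % 4 = 0 ∧ b % 2 = 0 ∨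
        (a + 2 * b + c) % 4 = 0 ∧ (b + c) % 2 = 0 := by
      rw [hD] at hmod
      rcases (by omega : (a : ℤ) % 4 = 0 ∨ (a : ℤ) % 4 = 1 ∨ (a : ℤ) % 4 = 2 ∨ (a : ℤ) % 4 = 3)
        with h1 | h1 | h1 | h1 <;>
      rcases (by omega : b % 4 = 0 ∨ b % 4 = 1 ∨ b % 4 = 2 ∨ b % 4 = 3)
        with h2 | h2 | h2 | h2 <;>
      rw [h1, h2] at hmod <;> omega
    rcases hcases with ⟨h1, h2⟩ | ⟨h1, h2⟩ | ⟨h1, h2⟩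
    · exact hsuper a b c ha'.le hc hdet' h1 h2
    · exact (hsuper c b a hc ha'.le (by linear_combination hdet') h1 h2).swap
    · have hpos : 0 ≤ a + 2 * b + c := by
        rw [abs_le] at hk
        linarith
      have := hsuper (a + 2 * b + c) (b + c) c hpos hc (by linear_combination hdet') h1 h2
      apply IsGramFive.swap
      apply IsGramFive.shear 1
      convert this.swap using 1 <;> ring
  · obtain ⟨x, y, z, h⟩ := exists_three_squares (by omega) hD
    exact IsGramFive.of_det_eq_sum_three_squares 0 0 (by simp) (by simpa using hc)
      (by simpa [hdet'] using h)
  · rcases (by omega : a = 1 ∨ 2 ≤ a) with rfl | ha2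
    · obtain rfl : b = 0 := by
        rw [abs_le] at hk
        push_cast at hk
        omega
      exact IsGramFive.of_det_eq_sum_three_squares (p := 0) (q := 0) (r := 0) 1 0 (by simp)
        (by simpa using hc) (by simp)
    have ha2' : (2 : ℤ) ≤ a := by exact_mod_cast ha2
    have hcases : ((D - a : ℤ) % 4 = 1 ∨ (D - a : ℤ) % 4 = 2) ∨
        ((D - c) % 4 = 1 ∨ (D - c) % 4 = 2) ∨
        (((D - a - c + 2 * b) % 4 = 1 ∨ (D - a - c + 2 * b) % 4 = 2) ∧ b % 2 = 1) := by
      rw [hD] at hmod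
      rcases (by omega : (a : ℤ) % 4 = 0 ∨ (a : ℤ) % 4 = 1 ∨ (a : ℤ) % 4 = 2 ∨ (a : ℤ) % 4 = 3)
        with h1 | h1 | h1 | h1 <;>
      rcases (by omega : b % 4 = 0 ∨ b % 4 = 1 ∨ b % 4 = 2 ∨ b % 4 = 3)
        with h2 | h2 | h2 | h2 <;>
      rw [h1, h2] at hmod <;> omega
    rcases hcases with h | h | ⟨h, hb⟩
    · obtain ⟨x, y, z, h⟩ := exists_three_squares (by nlinarith) h
      exact IsGramFive.of_det_eq_sum_three_squares 0 1 (by simp) (by linarith)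
        (by rw [← h, ← hdet']; ring)
    · obtain ⟨x, y, z, h⟩ := exists_three_squares (by nlinarith) h
      exact IsGramFive.of_det_eq_sum_three_squares 1 0 (by linarith) (by simpa using hc)
        (by rw [← h, ← hdet']; ring)
    · rw [abs_le] at hk
      rcases le_or_gt 0 b with hb0 | hb0
      · obtain ⟨x, y, z, h⟩ := exists_three_squares (n := D - a - c + 2 * b) (by nlinarith) h
        exact IsGramFive.of_det_eq_sum_three_squares 1 1 (by linarith) (by linarith)
          (by rw [← h, ← hdet']; ring)
      · obtain ⟨x, y, z, h⟩ := exists_three_squares (n := D - a - c - 2 * b) (by nlinarith)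
          (by omega)
        exact IsGramFive.of_det_eq_sum_three_squares 1 (-1) (by linarith) (by linarith)
          (by rw [← h, ← hdet']; ring)

theorem isGramFive_iff {a b c : ℤ} :
    IsGramFive a b c ↔ 0 ≤ a ∧ 0 ≤ c ∧ b ^ 2 ≤ a * c := by
  constructor
  · rintro ⟨u, v, rfl, rfl, rfl⟩
    refine ⟨dotProduct_self_star_nonneg u, dotProduct_self_star_nonneg v, ?_⟩
    simpa only [dotProduct, ← sq] using Finset.sum_mul_sq_le_sq_mul_sq Finset.univ u v
  · rintro ⟨ha, hc, hdet⟩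
    obtain ⟨a, rfl⟩ := Int.eq_ofNat_of_zero_le ha
    obtain ⟨D, hD⟩ := Int.eq_ofNat_of_zero_le (sub_nonneg.2 hdet)
    exact isGramFive_of_det_eq D a b c hc hD

/-- Positive semidefinite binary forms are closed under adding the square of a linear form. -/
theorem IsGramFive.add_sq {a b c : ℤ} (h : IsGramFive a b c) (m n : ℤ) :
    IsGramFive (m ^ 2 + a) (m * n + b) (n ^ 2 + c) := by
  rw [isGramFive_iff] at h ⊢
  obtain ⟨ha, hc, hdet⟩ := h
  have key : 2 * (m * n * b) ≤ m ^ 2 * c + n ^ 2 * a := by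
    refine (abs_le_of_sq_le_sq' ?_ (by positivity)).2
    nlinarith [sq_nonneg (m ^ 2 * c - n ^ 2 * a), mul_le_mul_of_nonneg_left hdet (sq_nonneg (m * n))]
  exact ⟨by positivity, by positivity, by linarith⟩

theorem θ_sq : θ ^ 2 = θ + 4 := by
  have := Real.sq_sqrt (show (0 : ℝ) ≤ 17 by norm_num)
  rw [θ]
  linarith

theorem θO_sq : θO ^ 2 = θO + 4 := Subtype.ext θ_sq

theorem irrational_θ : Irrational θ := by
  have h : Irrational (Real.sqrt 17) := by
    exact_mod_cast (show Nat.Prime 17 by norm_num).irrational_sqrt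
  have := (h.natCast_add 1).div_natCast (m := 2) (by norm_num)
  simpa [θ] using this

theorem O17.exists_eq_add_mul (x : O17) : ∃ m n : ℤ, x = m + n * θO := by
  obtain ⟨x, hx⟩ := x
  suffices h : ∃ m n : ℤ, x = m + n * θ by
    obtain ⟨m, n, h⟩ := h
    exact ⟨m, n, Subtype.ext h⟩
  induction hx using Algebra.adjoin_induction with
  | mem x hx =>
    rw [Set.mem_singleton_iff] at hx
    exact ⟨0, 1, by simp [hx]⟩
  | algebraMap r => exact ⟨r, 0, by simp⟩
  | add x y _ _ hx hy =>
    obtain ⟨m, n, rfl⟩ := hx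
    obtain ⟨m', n', rfl⟩ := hy
    exact ⟨m + m', n + n', by push_cast; ring⟩
  | mul x y _ _ hx hy =>
    obtain ⟨m, n, rfl⟩ := hx
    obtain ⟨m', n', rfl⟩ := hy
    refine ⟨m * m' + 4 * (n * n'), m * n' + n * m' + n * n', ?_⟩
    push_cast
    linear_combination (n * n' : ℝ) * θ_sq

theorem O17.add_mul_inj {m n m' n' : ℤ} (h : (m + n * θO : O17) = m' + n' * θO) :
    m = m' ∧ n = n' := by
  have hR : (m + n * θ : ℝ) = m' + n' * θ := congrArg Subtype.val h
  have hn : n = n' := by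
    by_contra hne
    have hsub : n - n' ≠ 0 := sub_ne_zero.2 hne
    refine (irrational_θ.intCast_mul hsub).ne_int (m' - m) ?_
    push_cast
    linarith
  subst hn
  exact ⟨by exact_mod_cast add_right_cancel hR, rfl⟩

/-- Every sum of squares in `ℤ[θ]` is the value at `(1, θ)` of a positive semidefinite binary
quadratic form over `ℤ`. -/
theorem O17.exists_isGramFive {x : O17} (h : IsSumSq x) :
    ∃ a b c : ℤ, IsGramFive a b c ∧ x = a + 2 * b * θO + c * θO ^ 2 := by
  induction h with
  | zero => exact ⟨0, 0, 0, isGramFive_iff.2 (by simp), by simp⟩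
  | sq_add y _ ih =>
    obtain ⟨a, b, c, habc, rfl⟩ := ih
    obtain ⟨m, n, rfl⟩ := exists_eq_add_mul y
    refine ⟨_, _, _, habc.add_sq m n, ?_⟩
    push_cast
    ring

theorem O17.exists_sum_five_squares {x : O17} (h : IsSumSq x) :
    ∃ y : Fin 5 → O17, x = ∑ i, y i ^ 2 := by
  obtain ⟨a, b, c, ⟨u, v, rfl, rfl, rfl⟩, rfl⟩ := exists_isGramFive h
  refine ⟨fun i => u i + v i * θO, ?_⟩
  simp only [dotProduct, Int.cast_sum, Int.cast_mul, Finset.mul_sum, Finset.sum_mul,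
    ← Finset.sum_add_distrib]
  exact Finset.sum_congr rfl fun i _ => by ring

theorem sum_three_squares_ne_seven (x y z : ℤ) : x ^ 2 + y ^ 2 + z ^ 2 ≠ 7 := by
  intro h
  have h8 : ∀ x y z : ZMod 8, x ^ 2 + y ^ 2 + z ^ 2 ≠ 7 := by decide
  exact h8 x y z (by exact_mod_cast congrArg (Int.cast : ℤ → ZMod 8) h)

theorem O17.seven_add_sq_ne_sum_four_squares (x : Fin 4 → O17) :
    (7 : O17) + θO ^ 2 ≠ ∑ i, x i ^ 2 := by
  intro h
  choose m n hx using fun i => exists_eq_add_mul (x i)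
  have hsq : ∀ i, x i ^ 2 = (m i ^ 2 + 4 * n i ^ 2 : ℤ) + (2 * (m i * n i) + n i ^ 2 : ℤ) * θO := by
    intro i
    rw [hx]
    push_cast
    linear_combination (n i ^ 2 : O17) * θO_sq
  have hsum : ((11 : ℤ) + (1 : ℤ) * θO : O17) = (∑ i, (m i ^ 2 + 4 * n i ^ 2) : ℤ)
      + (∑ i, (2 * (m i * n i) + n i ^ 2) : ℤ) * θO := by
    simp only [hsq, Finset.sum_add_distrib, ← Finset.sum_mul, ← Int.cast_sum] at h
    rw [Finset.sum_add_distrib, Finset.sum_add_distrib, ← h, θO_sq]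
    push_cast
    ring
  obtain ⟨h1, h2⟩ := add_mul_inj hsum
  simp only [Finset.sum_add_distrib, ← Finset.mul_sum] at h1 h2
  have hm0 : 0 ≤ ∑ i, m i ^ 2 := Finset.sum_nonneg fun i _ => sq_nonneg (m i)
  have hn0 : 0 ≤ ∑ i, n i ^ 2 := Finset.sum_nonneg fun i _ => sq_nonneg (n i)
  have hn1 : ∑ i, n i ^ 2 = 1 := by omega
  obtain ⟨i, -, hi⟩ := Finset.exists_ne_zero_of_sum_ne_zero (hn1.trans_ne one_ne_zero)
  have hi1 : 1 ≤ n i ^ 2 := (sq_nonneg (n i)).lt_of_ne' hi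
  have hrest : ∀ j, n (i.succAbove j) = 0 := by
    rw [Fin.sum_univ_succAbove _ i] at hn1
    have h0 : 0 ≤ ∑ j, n (i.succAbove j) ^ 2 := Finset.sum_nonneg fun j _ => sq_nonneg _
    have hzero : ∑ j, n (i.succAbove j) ^ 2 = 0 := by omega
    intro j
    exact sq_eq_zero_iff.1 ((Finset.sum_eq_zero_iff_of_nonneg fun j _ => sq_nonneg _).1 hzero j
      (Finset.mem_univ j))
  have hmi : m i = 0 := by
    have hmn : ∑ i, m i * n i = 0 := by omega
    rw [Fin.sum_univ_succAbove _ i] at hmn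
    simpa [hrest, ne_zero_pow two_ne_zero hi] using hmn
  rw [hn1, Fin.sum_univ_succAbove _ i, hmi, Fin.sum_univ_three] at h1
  exact sum_three_squares_ne_seven (m (i.succAbove 0)) (m (i.succAbove 1)) (m (i.succAbove 2))
    (by linarith)

/-- In `O = ℤ[(1+√17)/2]`, the ring of integers of `ℚ(√17)`, the element
`7 + θ²` is a sum of five squares but not a sum of four squares; consequently the
Pythagoras number of `O` equals `5` (every sum of squares in `O` is a sum of five
squares, and `7 + θ²` is a sum of squares which is not a sum of four squares). -/
theorem pythagoras_number_of_Z_sqrt17_eq_five :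
    (∃ x : Fin 5 → O17, (7 : O17) + θO ^ 2 = ∑ i, x i ^ 2) ∧
    ¬ (∃ x : Fin 4 → O17, (7 : O17) + θO ^ 2 = ∑ i, x i ^ 2) ∧
    (∀ a : O17, IsSumSq a → ∃ x : Fin 5 → O17, a = ∑ i, x i ^ 2) := by
  refine ⟨⟨![2, 1, 1, 1, θO], ?_⟩, fun ⟨x, hx⟩ => O17.seven_add_sq_ne_sum_four_squares x hx,
    fun _ => O17.exists_sum_five_squares⟩
  simp [Fin.sum_univ_five]
  norm_num

end
end
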